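/- Let p be an odd prime and i ≥ 2 an integer, and let G be a finite p-group. Then the word ω = x^{p^i}[y₁,…,y_{p−1}]^{p^{i−1}}[z₁,…,z_p] is interchangeable in G; i.e., for every normal subgroup N ⊴ G, [ω(N), G] ≤ [N, ω(G)]·[ω(G), G]^p·[ω(G), G, G]. -/

import Mathlib

/-- The subgroup generated by `n`-th powers of elements of `H`. -/
def powSubgroup {G : Type*} [Group G] (H : Subgroup G) (n : ℕ) : Subgroup G :=
  Subgroup.closure {x | ∃ h ∈ H, h ^ n = x}

/-- The lower central series of a subgroup `H ≤ G`, as subgroups of `G`: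
`gammaSub H m = γ_{m+1}(H)`. -/
def gammaSub {G : Type*} [Group G] (H : Subgroup G) : ℕ → Subgroup G
  | 0 => H
  | m + 1 => ⁅gammaSub H m, H⁆

/-- The value `ω(H) = H^{p^i} γ_{p-1}(H)^{p^{i-1}} γ_p(H)` of the word
`ω = x^{p^i}[y₁,…,y_{p-1}]^{p^{i-1}}[z₁,…,z_p]`. -/
def omegaII {G : Type*} [Group G] (p i : ℕ) (H : Subgroup G) : Subgroup G :=
  powSubgroup H (p ^ i) ⊔ powSubgroup (gammaSub H (p - 2)) (p ^ (i - 1)) ⊔ gammaSub H (p - 1)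


section PolynomialSequence

open scoped commutatorElement

variable {G : Type*} [Group G]

/-- The multiplicative forward difference `n ↦ f (n + 1) * (f n)⁻¹` of a sequence. -/
def mulDiff (f : ℕ → G) : ℕ → G := fun n => f (n + 1) * (f n)⁻¹

/-- For `j ≤ m`, the `j`-th multiplicative difference of `f` takes values in `F (k + j)`. -/
def IsPolySeq (F : ℕ → Subgroup G) : ℕ → ℕ → (ℕ → G) → Prop
  | 0, k, f => ∀ n, f n ∈ F k
  | m + 1, k, f => (∀ n, f n ∈ F k) ∧ IsPolySeq F m (k + 1) (mulDiff f)

variable {F : ℕ → Subgroup G}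

theorem IsPolySeq.mem {m k : ℕ} {f : ℕ → G} (h : IsPolySeq F m k f) (n : ℕ) : f n ∈ F k := by
  cases m with
  | zero => exact h n
  | succ m => exact h.1 n

theorem IsPolySeq.mono (hF : Antitone F) {m k l : ℕ} {f : ℕ → G} (hkl : l ≤ k)
    (h : IsPolySeq F m k f) : IsPolySeq F m l f := by
  induction m generalizing k l f with
  | zero => exact fun n => hF hkl (h n)
  | succ m ih => exact ⟨fun n => hF hkl (h.1 n), ih (Nat.succ_le_succ hkl) h.2⟩

theorem IsPolySeq.of_succ {m k : ℕ} {f : ℕ → G} (h : IsPolySeq F (m + 1) k f) :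
    IsPolySeq F m k f := by
  induction m generalizing k f with
  | zero => exact h.1
  | succ m ih => exact ⟨h.1, ih h.2⟩

theorem mulDiff_mul (f g : ℕ → G) :
    mulDiff (f * g) = mulDiff f * (⁅f, mulDiff g⁆ * mulDiff g) := by
  ext n
  simp only [mulDiff, Pi.mul_apply, commutatorElement_def, Pi.inv_apply]
  group

theorem mulDiff_inv (f : ℕ → G) :
    mulDiff f⁻¹ = ⁅f⁻¹, (mulDiff f)⁻¹⁆ * (mulDiff f)⁻¹ := by
  ext n
  simp only [mulDiff, Pi.mul_apply, commutatorElement_def, Pi.inv_apply]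
  group

theorem mulDiff_commutator (f g : ℕ → G) :
    mulDiff ⁅f, g⁆ =
      (⁅mulDiff f, ⁅f, mulDiff g⁆⁆ * ⁅f, mulDiff g⁆) *
        ⁅mulDiff f * mulDiff g, ⁅f, g⁆⁆ *
        (⁅⁅f, g⁆, ⁅mulDiff f, mulDiff g⁆ *
            (⁅mulDiff g, ⁅mulDiff f, g⁆⁆ * ⁅mulDiff f, g⁆)⁆ *
          (⁅mulDiff f, mulDiff g⁆ * (⁅mulDiff g, ⁅mulDiff f, g⁆⁆ * ⁅mulDiff f, g⁆))) := by
  ext n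
  simp only [mulDiff, Pi.mul_apply, commutatorElement_def, Pi.inv_apply]
  group

/-- Polynomial sequences relative to a filtration are closed under products, inverses and
commutators. -/
theorem isPolySeq_closed (hF : Antitone F) (hcomm : ∀ a b, ⁅F a, F b⁆ ≤ F (a + b)) (m : ℕ) :
    (∀ k f g, IsPolySeq F m k f → IsPolySeq F m k g → IsPolySeq F m k (f * g)) ∧
    (∀ k f, IsPolySeq F m k f → IsPolySeq F m k f⁻¹) ∧
    (∀ a b f g, IsPolySeq F m a f → IsPolySeq F m b g → IsPolySeq F m (a + b) ⁅f, g⁆) := by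
  have hc : ∀ {m : ℕ} (a b : ℕ) (f g : ℕ → G), IsPolySeq F m a f → IsPolySeq F m b g →
      ∀ n, ⁅f, g⁆ n ∈ F (a + b) := fun a b f g hf hg n =>
    hcomm a b (Subgroup.commutator_mem_commutator (hf.mem n) (hg.mem n))
  induction m with
  | zero =>
    exact ⟨fun k f g hf hg n => mul_mem (hf n) (hg n), fun k f hf n => inv_mem (hf n), hc⟩
  | succ m ih =>
    obtain ⟨hmul, hinv, hcom⟩ := ih
    refine ⟨fun k f g hf hg => ⟨fun n => mul_mem (hf.1 n) (hg.1 n), ?_⟩,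
      fun k f hf => ⟨fun n => inv_mem (hf.1 n), ?_⟩, fun a b f g hf hg => ⟨hc a b f g hf hg, ?_⟩⟩
    · rw [mulDiff_mul]
      exact hmul _ _ _ hf.2 (hmul _ _ _
        ((hcom _ _ _ _ hf.of_succ hg.2).mono hF (Nat.le_add_left _ _)) hg.2)
    · rw [mulDiff_inv]
      have hd := hinv _ _ hf.2
      exact hmul _ _ _
        ((hcom _ _ _ _ (hinv _ _ hf.of_succ) hd).mono hF (Nat.le_add_left _ _)) hd
    · rw [mulDiff_commutator]
      have hf0 := hf.of_succ
      have hg0 := hg.of_succ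
      have hu := hf.2
      have hv := hg.2
      have hfv : IsPolySeq F m (a + b + 1) ⁅f, mulDiff g⁆ :=
        hcom a (b + 1) _ _ hf0 hv
      have hug : IsPolySeq F m (a + b + 1) ⁅mulDiff f, g⁆ :=
        (hcom _ _ _ _ hu hg0).mono hF (by lia)
      have huv : IsPolySeq F m (a + b + 1) ⁅mulDiff f, mulDiff g⁆ :=
        (hcom _ _ _ _ hu hv).mono hF (by lia)
      have hfg : IsPolySeq F m (a + b) ⁅f, g⁆ := hcom _ _ _ _ hf0 hg0
      have hw : IsPolySeq F m 1 (mulDiff f * mulDiff g) :=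
        hmul _ _ _ (hu.mono hF (by lia)) (hv.mono hF (by lia))
      have hx := hmul _ _ _ huv
        (hmul _ _ _ ((hcom _ _ _ _ hv hug).mono hF (by lia)) hug)
      exact hmul _ _ _
        (hmul _ _ _ (hmul _ _ _ ((hcom _ _ _ _ hu hfv).mono hF (by lia)) hfv)
          ((hcom _ _ _ _ hw hfg).mono hF (by lia)))
        (hmul _ _ _ ((hcom _ _ _ _ hfg hx).mono hF (by lia)) hx)

theorem isPolySeq_one (m k : ℕ) : IsPolySeq F m k 1 := by
  induction m generalizing k with
  | zero => exact fun n => one_mem _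
  | succ m ih =>
    refine ⟨fun n => one_mem _, ?_⟩
    have : mulDiff (1 : ℕ → G) = 1 := by ext n; simp [mulDiff]
    rw [this]
    exact ih _

theorem isPolySeq_pow_choose (hF : Antitone F) (m k j : ℕ) {a : G} (ha : a ∈ F (k + j)) :
    IsPolySeq F m k fun n => a ^ n.choose j := by
  induction m generalizing k j with
  | zero => exact fun n => pow_mem (hF (Nat.le_add_right _ _) ha) _
  | succ m ih =>
    refine ⟨fun n => pow_mem (hF (Nat.le_add_right _ _) ha) _, ?_⟩
    cases j with
    | zero =>
      have : mulDiff (fun n => a ^ n.choose 0) = 1 := by ext n; simp [mulDiff]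
      exact this ▸ isPolySeq_one _ _
    | succ j =>
      have : mulDiff (fun n => a ^ n.choose (j + 1)) = fun n => a ^ n.choose j := by
        ext n
        simp [mulDiff, Nat.choose_succ_succ, pow_add]
      rw [this]
      exact ih _ _ (by rwa [add_right_comm, add_assoc])

theorem IsPolySeq.mem_of_forall_lt {k j : ℕ} {f : ℕ → G} (hf : IsPolySeq F j k f)
    (h0 : ∀ n < j, f n = 1) : f j ∈ F (k + j) := by
  induction j generalizing k f with
  | zero => exact hf 0
  | succ j ih =>
    have h := ih hf.2 fun n hn => by simp [mulDiff, h0 n (by lia), h0 (n + 1) (by lia)]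
    simpa [mulDiff, h0 j (by lia), add_comm, add_left_comm] using h

theorem IsPolySeq.eq_one_of_pow_choose (hF : Antitone F)
    (hcomm : ∀ a b, ⁅F a, F b⁆ ≤ F (a + b)) {q j : ℕ}
    (hq : ∀ i, j ≤ i → ∀ a ∈ F i, a ^ q.choose i = 1) {f : ℕ → G}
    (hf : ∀ m, IsPolySeq F m 0 f) (h0 : ∀ n < j, f n = 1) : f q = 1 := by
  by_cases hj : q < j
  · exact h0 q hj
  have ha : (f j)⁻¹ ∈ F (0 + j) := inv_mem ((hf j).mem_of_forall_lt h0)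
  have key := IsPolySeq.eq_one_of_pow_choose hF hcomm (q := q) (j := j + 1)
    (fun i hi => hq i (by lia)) (f := f * fun n => (f j)⁻¹ ^ n.choose j)
    (fun m => (isPolySeq_closed hF hcomm m).1 _ _ _ (hf m) (isPolySeq_pow_choose hF m 0 j ha))
    (fun n hn => by
      rcases Nat.lt_succ_iff_lt_or_eq.mp hn with h | rfl
      · simp [h0 n h, Nat.choose_eq_zero_of_lt h]
      · simp)
  rwa [Pi.mul_apply, hq j le_rfl _ (by simpa using ha), mul_one] at key
termination_by q + 1 - j

/-- A consequence of the Hall–Petrescu formula: if the terms of a filtration are killed by the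
relevant binomial coefficients, then the `q`-th power map is multiplicative. -/
theorem mul_pow_of_pow_choose (hF : Antitone F) (hcomm : ∀ a b, ⁅F a, F b⁆ ≤ F (a + b)) {q : ℕ}
    (hq : ∀ j, 2 ≤ j → ∀ a ∈ F j, a ^ q.choose j = 1) {x y : G} (hx : x ∈ F 1) (hy : y ∈ F 1) :
    (x * y) ^ q = x ^ q * y ^ q := by
  have hpow : ∀ z ∈ F 1, ∀ m, IsPolySeq F m 0 fun n => z ^ n := fun z hz m => by
    simpa using isPolySeq_pow_choose hF m 0 1 hz
  have key := IsPolySeq.eq_one_of_pow_choose hF hcomm hq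
    (f := (fun n => (x * y) ^ n) * ((fun n => x ^ n) * fun n => y ^ n)⁻¹)
    (fun m => by
      obtain ⟨hmul, hinv, -⟩ := isPolySeq_closed hF hcomm m
      exact hmul _ _ _ (hpow _ (mul_mem hx hy) m)
        (hinv _ _ (hmul _ _ _ (hpow _ hx m) (hpow _ hy m))))
    (fun n hn => by interval_cases n <;> simp)
  simpa [mul_inv_eq_one, ← mul_inv_rev] using key

end PolynomialSequence

section IteratedCommutator

variable {G : Type*} [Group G]

/-- The left-normed commutator subgroup `[A, B, …, B]` with `m` copies of `B`. -/
def iterCommutator (A B : Subgroup G) : ℕ → Subgroup G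
  | 0 => A
  | m + 1 => ⁅iterCommutator A B m, B⁆

theorem gammaSub_eq_iterCommutator (H : Subgroup G) (m : ℕ) :
    gammaSub H m = iterCommutator H H m := by
  induction m with
  | zero => rfl
  | succ m ih => rw [gammaSub, ih, iterCommutator]

instance iterCommutator_normal (A B : Subgroup G) [A.Normal] [B.Normal] (m : ℕ) :
    (iterCommutator A B m).Normal := by
  induction m with
  | zero => assumption
  | succ m ih => exact Subgroup.commutator_normal _ _

instance gammaSub_normal (H : Subgroup G) [H.Normal] (m : ℕ) : (gammaSub H m).Normal := by
  rw [gammaSub_eq_iterCommutator]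
  infer_instance

theorem iterCommutator_mono {A A' B B' : Subgroup G} (hA : A ≤ A') (hB : B ≤ B') (m : ℕ) :
    iterCommutator A B m ≤ iterCommutator A' B' m := by
  induction m with
  | zero => exact hA
  | succ m ih => exact Subgroup.commutator_mono ih hB

theorem iterCommutator_antitone (A B : Subgroup G) [A.Normal] [B.Normal] :
    Antitone (iterCommutator A B) :=
  antitone_nat_of_succ_le fun _ => Subgroup.commutator_le_left _ _

theorem iterCommutator_commutator (A B : Subgroup G) (m : ℕ) :
    iterCommutator ⁅A, B⁆ B m = iterCommutator A B (m + 1) := by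
  induction m with
  | zero => rfl
  | succ m ih => rw [iterCommutator, ih, ← iterCommutator]

theorem iterCommutator_iterCommutator (A B : Subgroup G) (m n : ℕ) :
    iterCommutator (iterCommutator A B m) B n = iterCommutator A B (m + n) := by
  induction n with
  | zero => rfl
  | succ n ih => rw [iterCommutator, ih, ← add_assoc, iterCommutator]

/-- The three subgroups lemma modulo a normal subgroup. -/
theorem commutator_commutator_le_of_rotate {H₁ H₂ H₃ M : Subgroup G} [M.Normal]
    (h1 : ⁅⁅H₂, H₃⁆, H₁⁆ ≤ M) (h2 : ⁅⁅H₃, H₁⁆, H₂⁆ ≤ M) : ⁅⁅H₁, H₂⁆, H₃⁆ ≤ M := by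
  rw [← QuotientGroup.ker_mk' M, ← Subgroup.map_eq_bot_iff] at h1 h2 ⊢
  simp only [Subgroup.map_commutator] at h1 h2 ⊢
  exact Subgroup.commutator_commutator_eq_bot_of_rotate h1 h2

theorem commutator_gammaSub_le (A B : Subgroup G) [A.Normal] [B.Normal] (m : ℕ) :
    ⁅A, gammaSub B m⁆ ≤ iterCommutator A B (m + 1) := by
  induction m generalizing A with
  | zero => exact le_rfl
  | succ m ih =>
    rw [gammaSub, Subgroup.commutator_comm]
    apply commutator_commutator_le_of_rotate
    · rw [Subgroup.commutator_comm B A]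
      exact (ih _).trans (iterCommutator_commutator A B _).le
    · exact Subgroup.commutator_mono (ih A) le_rfl

theorem iterCommutator_top_le (A : Subgroup G) (m : ℕ) :
    iterCommutator A ⊤ m ≤ gammaSub ⊤ m := by
  rw [gammaSub_eq_iterCommutator]
  exact iterCommutator_mono le_top le_rfl m

theorem gammaSub_top_antitone : Antitone (gammaSub (⊤ : Subgroup G)) :=
  antitone_nat_of_succ_le fun _ => Subgroup.commutator_le_left _ _

theorem iterCommutator_top_le_gammaSub_add (A : Subgroup G) (m n : ℕ) (hA : A ≤ gammaSub ⊤ m) :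
    iterCommutator A ⊤ n ≤ gammaSub ⊤ (m + n) := by
  rw [gammaSub_eq_iterCommutator, ← iterCommutator_iterCommutator, ← gammaSub_eq_iterCommutator]
  exact iterCommutator_mono hA le_rfl n

end IteratedCommutator

section PowerMap

variable {G : Type*} [Group G]

/-- The filtration `⟨x⟩U, ⟨x⟩U, [U, G], [U, G, G], …`. -/
def zpowersFiltration (x : G) (U : Subgroup G) : ℕ → Subgroup G
  | 0 => Subgroup.zpowers x ⊔ U
  | 1 => Subgroup.zpowers x ⊔ U
  | j + 2 => iterCommutator U ⊤ (j + 1)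

theorem zpowersFiltration_antitone (x : G) (U : Subgroup G) [U.Normal] :
    Antitone (zpowersFiltration x U) := by
  refine antitone_nat_of_succ_le fun n => ?_
  match n with
  | 0 => exact le_rfl
  | 1 => exact (Subgroup.commutator_le_left U ⊤).trans le_sup_right
  | n + 2 => exact Subgroup.commutator_le_left _ _

theorem commutator_zpowers_sup_le (x : G) (U : Subgroup G) [U.Normal] :
    ⁅Subgroup.zpowers x ⊔ U, Subgroup.zpowers x ⊔ U⁆ ≤ ⁅U, ⊤⁆ := by
  have hU : U.map (QuotientGroup.mk' ⁅U, ⊤⁆) ≤ Subgroup.center _ := by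
    rw [← Subgroup.commutator_top_right_eq_bot_iff_le_center,
      ← Subgroup.map_top_of_surjective _ (QuotientGroup.mk'_surjective ⁅U, ⊤⁆),
      ← Subgroup.map_commutator, Subgroup.map_eq_bot_iff, QuotientGroup.ker_mk']
  have hx : Subgroup.zpowers (QuotientGroup.mk' ⁅U, ⊤⁆ x) ≤
      Subgroup.centralizer (Subgroup.zpowers (QuotientGroup.mk' ⁅U, ⊤⁆ x)) :=
    Subgroup.le_centralizer _
  conv_rhs => rw [← QuotientGroup.ker_mk' ⁅U, ⊤⁆]
  rw [← Subgroup.map_eq_bot_iff, Subgroup.map_commutator, Subgroup.map_sup, MonoidHom.map_zpowers,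
    Subgroup.commutator_eq_bot_iff_le_centralizer]
  refine sup_le ?_ (hU.trans (Subgroup.center_le_centralizer _))
  rw [Subgroup.le_centralizer_iff]
  exact sup_le hx (hU.trans (Subgroup.center_le_centralizer _))

theorem commutator_zpowersFiltration_le (x : G) (U : Subgroup G) [U.Normal] (a b : ℕ) :
    ⁅zpowersFiltration x U a, zpowersFiltration x U b⁆ ≤ zpowersFiltration x U (a + b) := by
  have hle : ∀ n j, ⁅iterCommutator U ⊤ j, zpowersFiltration x U n⁆ ≤
      iterCommutator U ⊤ (j + n) := fun n j => by
    match n with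
    | 0 => exact Subgroup.commutator_le_left _ _
    | 1 => exact Subgroup.commutator_mono le_rfl le_top
    | n + 2 =>
      refine (Subgroup.commutator_mono le_rfl (iterCommutator_top_le U (n + 1))).trans ?_
      exact (commutator_gammaSub_le _ _ _).trans (iterCommutator_iterCommutator _ _ _ _).le
  have hself := commutator_zpowers_sup_le x U
  have hgen : ∀ a b, ⁅zpowersFiltration x U (a + 2), zpowersFiltration x U b⁆ ≤
      zpowersFiltration x U (a + 2 + b) := fun a b => by
    rw [add_right_comm]
    refine (hle b (a + 1)).trans (le_of_eq ?_)
    rw [zpowersFiltration, add_right_comm]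
  match a, b with
  | a + 2, b => exact hgen a b
  | a, b + 2 =>
    rw [Subgroup.commutator_comm, add_comm a]
    exact hgen b a
  | 0, 0 | 0, 1 | 1, 0 =>
    exact hself.trans ((Subgroup.commutator_le_left U ⊤).trans le_sup_right)
  | 1, 1 => exact hself

theorem pow_dvd_choose_of_lt {p : ℕ} (hp : p.Prime) (i : ℕ) {j : ℕ} (hj : 0 < j) (hjp : j < p) :
    p ^ i ∣ (p ^ i).choose j := by
  obtain ⟨k, rfl⟩ := Nat.exists_eq_add_of_le' hj
  obtain ⟨q, hq⟩ := Nat.exists_eq_add_of_le' (Nat.pos_of_ne_zero (pow_ne_zero i hp.ne_zero))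
  have h := Nat.add_one_mul_choose_eq q k
  rw [← hq] at h
  exact ((Nat.coprime_of_lt_prime (by lia) hjp hp).pow_left i).dvd_of_dvd_mul_right
    (Dvd.intro _ h)

theorem mul_pow_of_filtration {p i : ℕ} (hp : p.Prime) (hi : 2 ≤ i) {U : Subgroup G} [U.Normal]
    (hU : U ≤ gammaSub ⊤ 1) (hUexp : ∀ a ∈ ⁅U, (⊤ : Subgroup G)⁆, a ^ p ^ i = 1)
    (hexp : ∀ a ∈ gammaSub (⊤ : Subgroup G) p, a ^ p = 1)
    (hbot : gammaSub (⊤ : Subgroup G) (p + 1) = ⊥) (x : G) {y : G} (hy : y ∈ U) :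
    (x * y) ^ p ^ i = x ^ p ^ i * y ^ p ^ i := by
  refine mul_pow_of_pow_choose (zpowersFiltration_antitone x U)
    (commutator_zpowersFiltration_le x U) (fun j hj a ha => ?_)
    (Subgroup.mem_sup_left (Subgroup.mem_zpowers x)) (Subgroup.mem_sup_right hy)
  have hmem : a ∈ gammaSub (⊤ : Subgroup G) j := by
    obtain ⟨j, rfl⟩ := Nat.exists_eq_add_of_le' hj
    have := iterCommutator_top_le_gammaSub_add U 1 (j + 1) hU ha
    rwa [add_comm, add_assoc] at this
  rcases lt_trichotomy j p with h | rfl | h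
  · obtain ⟨c, hc⟩ := pow_dvd_choose_of_lt hp i (by lia : 0 < j) h
    rw [hc, pow_mul, hUexp a (zpowersFiltration_antitone x U hj ha), one_pow]
  · obtain ⟨c, hc⟩ := hp.dvd_choose_pow (n := i) (k := j) hp.ne_zero
      (by simpa using (Nat.pow_lt_pow_right hp.one_lt (by lia : 1 < i)).ne)
    rw [hc, pow_mul, hexp a hmem, one_pow]
  · have := gammaSub_top_antitone (G := G) h hmem
    rw [Nat.succ_eq_add_one, hbot, Subgroup.mem_bot] at this
    rw [this, one_pow]

end PowerMap

section WordSubgroup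

variable {G : Type*} [Group G]

theorem pow_mem_powSubgroup {H : Subgroup G} {h : G} (hh : h ∈ H) (n : ℕ) :
    h ^ n ∈ powSubgroup H n :=
  Subgroup.subset_closure ⟨h, hh, rfl⟩

instance powSubgroup_normal (H : Subgroup G) [hH : H.Normal] (n : ℕ) :
    (powSubgroup H n).Normal := by
  have : powSubgroup H n = Subgroup.normalClosure {x | ∃ h ∈ H, h ^ n = x} := by
    refine le_antisymm Subgroup.closure_le_normalClosure (Subgroup.closure_mono ?_)
    intro x hx
    obtain ⟨_, ⟨h, hh, rfl⟩, c⟩ := Group.mem_conjugatesOfSet_iff.mp hx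
    obtain ⟨g, rfl⟩ := isConj_iff.mp c
    exact ⟨g * h * g⁻¹, hH.conj_mem h hh g, conj_pow⟩
  exact this ▸ Subgroup.normalClosure_normal

instance omegaII_normal (p i : ℕ) (H : Subgroup G) [H.Normal] : (omegaII p i H).Normal := by
  unfold omegaII
  infer_instance

variable {G' : Type*} [Group G']

theorem map_powSubgroup (f : G →* G') (H : Subgroup G) (n : ℕ) :
    (powSubgroup H n).map f = powSubgroup (H.map f) n := by
  rw [powSubgroup, MonoidHom.map_closure, powSubgroup]
  congr 1
  ext x
  simp

theorem map_gammaSub (f : G →* G') (H : Subgroup G) (m : ℕ) :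
    (gammaSub H m).map f = gammaSub (H.map f) m := by
  induction m with
  | zero => rfl
  | succ m ih => rw [gammaSub, Subgroup.map_commutator, ih, gammaSub]

theorem map_omegaII (f : G →* G') (p i : ℕ) (H : Subgroup G) :
    (omegaII p i H).map f = omegaII p i (H.map f) := by
  simp only [omegaII, Subgroup.map_sup, map_powSubgroup, map_gammaSub]

end WordSubgroup

section Centrality

open scoped commutatorElement

variable {G : Type*} [Group G]

theorem commutatorElement_pow_eq_one {a b : G} {q : ℕ} (hab : Commute (a ^ q) b)
    (h : (a⁻¹ * ⁅a, b⁆) ^ q = a⁻¹ ^ q * ⁅a, b⁆ ^ q) : ⁅a, b⁆ ^ q = 1 := by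
  have e : a⁻¹ * ⁅a, b⁆ = b * a⁻¹ * b⁻¹ := by
    rw [commutatorElement_def]
    group
  rw [e, conj_pow, inv_pow, ← hab.inv_left.eq, mul_inv_cancel_right] at h
  exact left_eq_mul.mp h

theorem pow_mem_center_of_mul_pow {a : G} {q : ℕ}
    (h : ∀ g : G, (a * ⁅a⁻¹, g⁆) ^ q = a ^ q * ⁅a⁻¹, g⁆ ^ q) (h1 : ∀ g : G, ⁅a⁻¹, g⁆ ^ q = 1) :
    a ^ q ∈ Subgroup.center G := by
  refine Subgroup.mem_center_iff.mpr fun g => ?_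
  have e : a * ⁅a⁻¹, g⁆ = g * a * g⁻¹ := by
    rw [commutatorElement_def]
    group
  have := h g
  rw [e, conj_pow, h1, mul_one] at this
  exact mul_inv_eq_iff_eq_mul.mp this

theorem commute_of_commutator_eq_bot {H K : Subgroup G} (h : ⁅H, K⁆ = ⊥) {x y : G} (hx : x ∈ H)
    (hy : y ∈ K) : Commute x y :=
  commutatorElement_eq_one_iff_commute.mp <| by
    simpa [h] using Subgroup.commutator_mem_commutator hx hy

/-- If `p ^ i`-th powers centralize `N`, `γ_{p+1}(G)` has exponent `p` and `γ_{p+2}(G) = 1`, then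
`[N, G]`, `[N, G, G]`, … all have exponent dividing `p ^ i`. -/
theorem iterCommutator_pow_eq_one {p i : ℕ} (hp : p.Prime) (hi : 2 ≤ i) {N : Subgroup G} [N.Normal]
    (hpow : ∀ n ∈ N, ∀ g : G, Commute (g ^ p ^ i) n)
    (hexp : ∀ a ∈ gammaSub (⊤ : Subgroup G) p, a ^ p = 1)
    (hbot : gammaSub (⊤ : Subgroup G) (p + 1) = ⊥) (k : ℕ) :
    ∀ a ∈ iterCommutator N ⊤ (k + 1), a ^ p ^ i = 1 := by
  by_cases hk : p < k + 1
  · intro a ha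
    have := gammaSub_top_antitone hk (iterCommutator_top_le N _ ha)
    rw [Nat.succ_eq_add_one, hbot, Subgroup.mem_bot] at this
    rw [this, one_pow]
  have hle : iterCommutator N (⊤ : Subgroup G) (k + 1) ≤ gammaSub ⊤ 1 :=
    (iterCommutator_top_le N _).trans (gammaSub_top_antitone (by lia))
  have hmul : ∀ x, ∀ y ∈ iterCommutator N (⊤ : Subgroup G) (k + 1),
      (x * y) ^ p ^ i = x ^ p ^ i * y ^ p ^ i := fun x y hy =>
    mul_pow_of_filtration hp hi hle
      (iterCommutator_pow_eq_one hp hi hpow hexp hbot (k + 1)) hexp hbot x hy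
  intro a ha
  rw [iterCommutator, Subgroup.commutator_comm, Subgroup.commutator_def] at ha
  induction ha using Subgroup.closure_induction with
  | mem x hx =>
    obtain ⟨g, -, n, hn, rfl⟩ := hx
    refine commutatorElement_pow_eq_one
      (hpow n (iterCommutator_antitone N ⊤ (Nat.zero_le k) hn) g) (hmul _ _ ?_)
    rw [iterCommutator, Subgroup.commutator_comm]
    exact Subgroup.commutator_mem_commutator (Subgroup.mem_top g) hn
  | one => exact one_pow _
  | mul x y _ hy hx' hy' =>
    rw [hmul x y, hx', hy', one_mul]
    rwa [iterCommutator, Subgroup.commutator_comm, Subgroup.commutator_def]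
  | inv x _ hx' => rw [inv_pow, hx', inv_one]
termination_by p - k

theorem powSubgroup_le_center {p i : ℕ} (hp : p.Prime) (hi : 2 ≤ i) {N : Subgroup G} [N.Normal]
    (hpow : ∀ n ∈ N, ∀ g : G, Commute (g ^ p ^ i) n)
    (hexp : ∀ a ∈ gammaSub (⊤ : Subgroup G) p, a ^ p = 1)
    (hbot : gammaSub (⊤ : Subgroup G) (p + 1) = ⊥) :
    powSubgroup N (p ^ i) ≤ Subgroup.center G := by
  have hone := iterCommutator_pow_eq_one hp hi hpow hexp hbot
  rw [powSubgroup, Subgroup.closure_le]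
  rintro _ ⟨n, hn, rfl⟩
  have hmem : ∀ g : G, ⁅n⁻¹, g⁆ ∈ iterCommutator N ⊤ 1 := fun g =>
    Subgroup.commutator_mem_commutator (inv_mem hn) (Subgroup.mem_top g)
  exact pow_mem_center_of_mul_pow
    (fun g => mul_pow_of_filtration hp hi (iterCommutator_top_le N 1) (hone 1) hexp hbot n (hmem g))
    (fun g => hone 0 _ (hmem g))

/-- If `W` contains `γ_{r+2}(G)` and the `p ^ s`-th powers of `γ_{r+1}(G)`, centralizes `N`, and
`[W, G]` is central of exponent `p`, then `γ_{r+1}(N) ^ {p ^ s}` is central. -/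
theorem powSubgroup_gammaSub_le_center {p s r : ℕ} (hp : p.Prime) (hp2 : 2 < p) (hs : s ≠ 0)
    {N W : Subgroup G} [N.Normal] (hNW : ⁅N, W⁆ = ⊥) (hW : gammaSub ⊤ (r + 1) ≤ W)
    (hWpow : ∀ a ∈ gammaSub (⊤ : Subgroup G) r, a ^ p ^ s ∈ W)
    (hexp : ∀ a ∈ ⁅W, (⊤ : Subgroup G)⁆, a ^ p = 1)
    (hcent : ⁅⁅W, (⊤ : Subgroup G)⁆, (⊤ : Subgroup G)⁆ = ⊥) :
    powSubgroup (gammaSub N r) (p ^ s) ≤ Subgroup.center G := by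
  set V := iterCommutator ⊤ N (r + 1) with hV
  have hle : ∀ m, iterCommutator ⊤ N m ≤ gammaSub (⊤ : Subgroup G) m := fun m => by
    rw [gammaSub_eq_iterCommutator]
    exact iterCommutator_mono le_rfl le_top m
  have hVW : V ≤ W := (hle _).trans hW
  have hVN : V ≤ N := Subgroup.commutator_le_right _ _
  have hmul : ∀ x, ∀ y ∈ V, (x * y) ^ p ^ s = x ^ p ^ s * y ^ p ^ s := fun x y hy => by
    refine mul_pow_of_pow_choose (zpowersFiltration_antitone x V)
      (commutator_zpowersFiltration_le x V) (fun j hj a ha => ?_)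
      (Subgroup.mem_sup_left (Subgroup.mem_zpowers x)) (Subgroup.mem_sup_right hy)
    have hVW1 : iterCommutator V ⊤ 1 ≤ ⁅W, (⊤ : Subgroup G)⁆ := Subgroup.commutator_mono hVW le_rfl
    rcases hj.eq_or_lt with rfl | hj
    · obtain ⟨c, hc⟩ := (dvd_pow_self p hs).trans (pow_dvd_choose_of_lt hp s two_pos hp2)
      rw [hc, pow_mul, hexp a (hVW1 ha), one_pow]
    · have h3 : a ∈ ⁅iterCommutator V (⊤ : Subgroup G) 1, ⊤⁆ :=
        zpowersFiltration_antitone x V (Nat.succ_le_of_lt hj) ha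
      have := Subgroup.commutator_mono hVW1 (le_refl (⊤ : Subgroup G)) h3
      rw [hcent, Subgroup.mem_bot] at this
      rw [this, one_pow]
  have hone : ∀ v ∈ V, v ^ p ^ s = 1 := fun v hv => by
    rw [hV, iterCommutator, Subgroup.commutator_def] at hv
    induction hv using Subgroup.closure_induction with
    | mem x hx =>
      obtain ⟨a, ha, n, hn, rfl⟩ := hx
      exact commutatorElement_pow_eq_one
        (commute_of_commutator_eq_bot hNW hn (hWpow a (hle r ha))).symm
        (hmul _ _ (Subgroup.commutator_mem_commutator ha hn))
    | one => exact one_pow _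
    | mul x y _ hy hx' hy' => rw [hmul x y hy, hx', hy', one_mul]
    | inv x _ hx' => rw [inv_pow, hx', inv_one]
  rw [powSubgroup, Subgroup.closure_le]
  rintro _ ⟨n, hn, rfl⟩
  have hmem : ∀ g : G, ⁅n⁻¹, g⁆ ∈ V := fun g => by
    apply commutator_gammaSub_le
    rw [Subgroup.commutator_comm]
    exact Subgroup.commutator_mem_commutator (inv_mem hn) (Subgroup.mem_top g)
  exact pow_mem_center_of_mul_pow (fun g => hmul n _ (hmem g)) (fun g => hone _ (hmem g))

theorem omegaII_le_center {p i : ℕ} (hp : p.Prime) (hp2 : 2 < p) (hi : 2 ≤ i)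
    {N : Subgroup G} [N.Normal] (hN : ⁅N, omegaII p i (⊤ : Subgroup G)⁆ = ⊥)
    (hexp : ∀ a ∈ ⁅omegaII p i (⊤ : Subgroup G), (⊤ : Subgroup G)⁆, a ^ p = 1)
    (hcent : ⁅⁅omegaII p i (⊤ : Subgroup G), (⊤ : Subgroup G)⁆, (⊤ : Subgroup G)⁆ = ⊥) :
    omegaII p i N ≤ Subgroup.center G := by
  obtain ⟨r, rfl⟩ := Nat.exists_eq_add_of_le' hp2.le
  have hW : gammaSub ⊤ (r + 1) ≤ omegaII (r + 2) i (⊤ : Subgroup G) := le_sup_right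
  have hW1 : gammaSub ⊤ (r + 2) ≤ ⁅omegaII (r + 2) i (⊤ : Subgroup G), (⊤ : Subgroup G)⁆ :=
    Subgroup.commutator_mono hW le_rfl
  have hbot : gammaSub (⊤ : Subgroup G) (r + 2 + 1) = ⊥ :=
    le_bot_iff.mp ((Subgroup.commutator_mono hW1 le_rfl).trans hcent.le)
  refine sup_le (sup_le ?_ ?_) ?_
  · exact powSubgroup_le_center hp hi
      (fun n hn g => (commute_of_commutator_eq_bot hN hn (Subgroup.mem_sup_left
        (Subgroup.mem_sup_left (pow_mem_powSubgroup (Subgroup.mem_top g) _)))).symm)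
      (fun a ha => hexp a (hW1 ha)) hbot
  · exact powSubgroup_gammaSub_le_center hp hp2 (by lia) hN hW
      (fun a ha => Subgroup.mem_sup_left (Subgroup.mem_sup_right (pow_mem_powSubgroup ha _)))
      hexp hcent
  · rw [← Subgroup.commutator_top_left_eq_bot_iff_le_center, eq_bot_iff, ← hN,
      Subgroup.commutator_comm N]
    refine (commutator_gammaSub_le ⊤ N (r + 1)).trans (Subgroup.commutator_mono ?_ le_rfl)
    refine le_trans ?_ hW
    rw [gammaSub_eq_iterCommutator]
    exact iterCommutator_mono le_rfl le_top _

end Centrality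

/-- **Lemma 1(ii).** For `p` odd and `i ≥ 2`, the word
`ω = x^{p^i}[y₁,…,y_{p-1}]^{p^{i-1}}[z₁,…,z_p]` is interchangeable in any finite
`p`-group `G`: for every normal `N ⊴ G`,
`[ω(N),G] ≤ [N,ω(G)] ⬝ [ω(G),G]^p ⬝ [ω(G),G,G]`. -/
theorem omegaII_interchangeable {G : Type*} [Group G] [Finite G] {p i : ℕ}
    (hp : p.Prime) (hodd : Odd p) (hi : 2 ≤ i) (hG : IsPGroup p G)
    (N : Subgroup G) (hN : N.Normal) :
    ⁅omegaII p i N, (⊤ : Subgroup G)⁆ ≤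
      ⁅N, omegaII p i (⊤ : Subgroup G)⁆ ⊔
        powSubgroup ⁅omegaII p i (⊤ : Subgroup G), (⊤ : Subgroup G)⁆ p ⊔
        ⁅⁅omegaII p i (⊤ : Subgroup G), (⊤ : Subgroup G)⁆, (⊤ : Subgroup G)⁆ := by
  have hp2 : 2 < p := lt_of_le_of_ne hp.two_le fun h =>
    absurd (h ▸ hodd) (by decide)
  set M := ⁅N, omegaII p i (⊤ : Subgroup G)⁆ ⊔
    powSubgroup ⁅omegaII p i (⊤ : Subgroup G), (⊤ : Subgroup G)⁆ p ⊔
    ⁅⁅omegaII p i (⊤ : Subgroup G), (⊤ : Subgroup G)⁆, (⊤ : Subgroup G)⁆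
  have hsurj := QuotientGroup.mk'_surjective M
  have htop := Subgroup.map_top_of_surjective (QuotientGroup.mk' M) hsurj
  have hbot : ∀ K ≤ M, K.map (QuotientGroup.mk' M) = ⊥ := fun K hK => by
    rwa [Subgroup.map_eq_bot_iff, QuotientGroup.ker_mk']
  have hNbar : (N.map (QuotientGroup.mk' M)).Normal := hN.map _ hsurj
  have key : omegaII p i (N.map (QuotientGroup.mk' M)) ≤ Subgroup.center (G ⧸ M) := by
    apply omegaII_le_center hp hp2 hi
    · rw [← htop, ← map_omegaII, ← Subgroup.map_commutator]
      exact hbot _ (le_sup_left.trans le_sup_left)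
    · intro a ha
      have h := pow_mem_powSubgroup ha p
      rwa [← htop, ← map_omegaII, ← Subgroup.map_commutator, ← map_powSubgroup,
        hbot _ (le_sup_right.trans le_sup_left), Subgroup.mem_bot] at h
    · rw [← htop, ← map_omegaII, ← Subgroup.map_commutator, ← Subgroup.map_commutator]
      exact hbot _ le_sup_right
  rwa [← Subgroup.commutator_top_right_eq_bot_iff_le_center, ← htop, ← map_omegaII,
    ← Subgroup.map_commutator, Subgroup.map_eq_bot_iff, QuotientGroup.ker_mk'] at key
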